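/- Let θ = 1/4 and σ < 1. The open square Q₂ = {z ∈ ℂ : 0 < Re z < 1-σ and -(1-σ) < Im z < 0}, whose center is z₂ = (σ-1)(-1+i)/2, is invariant under T_{1/4,σ}; on Q₂ the map T_{1/4,σ} acts as the rotation z ↦ i(z - z₂) + z₂ of angle π/2 about z₂, every z ∈ Q₂ satisfies Im(T_{1/4,σ}^n z) < 0 for all n (itinerary 2^ω), and T_{1/4,σ}^4 z = z. -/

import Mathlib

/-- The piecewise rotation `T_{θ,σ}`:
`T_{θ,σ}(z) = e^{2πiθ}(z+σ+1)` if `Im z > 0` and `e^{2πiθ}(z+σ-1)` if `Im z < 0`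
(points of the real axis are excluded from the dynamics). -/
noncomputable def pwRot (θ σ : ℝ) (z : ℂ) : ℂ :=
  if 0 < z.im then Complex.exp (2 * Real.pi * θ * Complex.I) * (z + σ + 1)
  else Complex.exp (2 * Real.pi * θ * Complex.I) * (z + σ - 1)

/-- On the closed lower half-plane `T_{1/4,σ}` is the affine map `z ↦ i(z + σ - 1)`. -/
theorem pwRot_quarter_of_im_nonpos (σ : ℝ) {z : ℂ} (hz : z.im ≤ 0) :
    pwRot (1/4) σ z = Complex.I * (z + σ - 1) := by
  have hexp : Complex.exp (2 * Real.pi * ((1/4 : ℝ) : ℂ) * Complex.I) = Complex.I := by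
    refine (congrArg Complex.exp ?_).trans Complex.exp_pi_div_two_mul_I
    push_cast
    ring
  rw [pwRot, if_neg hz.not_gt, hexp]

/-- For `θ = 1/4` and `σ < 1`, the open square `Q₂` centered at `z₂ = (σ-1)(-1+i)/2` is
invariant under `T_{1/4,σ}`, on which the map acts as the rotation of angle `π/2` about
`z₂`; every point of `Q₂` has itinerary `2^ω` and is periodic of period `4`. -/
theorem stmt_7 (σ : ℝ) (hσ : σ < 1)
    (Q₂ : Set ℂ)
    (hQ₂ : Q₂ = {z : ℂ | 0 < z.re ∧ z.re < 1 - σ ∧ -(1 - σ) < z.im ∧ z.im < 0})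
    (z₂ : ℂ) (hz₂ : z₂ = (σ - 1) * (-1 + Complex.I) / 2) :
    (∀ z ∈ Q₂, pwRot (1/4) σ z ∈ Q₂) ∧
    (∀ z ∈ Q₂, pwRot (1/4) σ z = Complex.I * (z - z₂) + z₂) ∧
    (∀ z ∈ Q₂, (∀ n : ℕ, ((pwRot (1/4) σ)^[n] z).im < 0) ∧ (pwRot (1/4) σ)^[4] z = z) := by
  have hrot : ∀ z ∈ Q₂, pwRot (1/4) σ z = Complex.I * (z - z₂) + z₂ := by
    intro z hz
    rw [hQ₂] at hz
    rw [pwRot_quarter_of_im_nonpos σ hz.2.2.2.le, hz₂]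
    linear_combination ((σ : ℂ) - 1) / 2 * Complex.I_sq
  have hinv : ∀ z ∈ Q₂, pwRot (1/4) σ z ∈ Q₂ := by
    intro z hz
    rw [hQ₂] at hz ⊢
    obtain ⟨hre, hre', him, him'⟩ := hz
    rw [pwRot_quarter_of_im_nonpos σ him'.le]
    simp only [Set.mem_ofPred_eq, Complex.mul_re, Complex.mul_im, Complex.I_re, Complex.I_im,
      Complex.sub_re, Complex.sub_im, Complex.add_re, Complex.add_im, Complex.ofReal_re,
      Complex.ofReal_im, Complex.one_re, Complex.one_im]
    refine ⟨?_, ?_, ?_, ?_⟩ <;> linarith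
  refine ⟨hinv, hrot, fun z hz => ⟨fun n => ?_, ?_⟩⟩
  · have hn : (pwRot (1/4) σ)^[n] z ∈ Q₂ := Set.MapsTo.iterate hinv n hz
    rw [hQ₂] at hn
    exact hn.2.2.2
  · have h₁ := hinv z hz
    have h₂ := hinv _ h₁
    have h₃ := hinv _ h₂
    simp only [Function.iterate_succ_apply, Function.iterate_zero_apply]
    rw [hrot _ h₃, hrot _ h₂, hrot _ h₁, hrot _ hz]
    linear_combination (z - z₂) * (Complex.I ^ 2 - 1) * Complex.I_sq
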